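/- If ψ = (c1, c2, c3) : ℝ → ℂ³ is differentiable and solves the Schrödinger equation i dψ/dt = H(t) ψ, then the real variables x1 = Re c1, x2 = −Im c2, x3 = −Re c3 satisfy the closed real system ẋ1 = −Δ x2, ẋ2 = Δ x1 − u(t) x3, ẋ3 = u(t) x2; that is, the real dynamics of (x1, x2, x3) decouple from the remaining real variables Im c1, Re c2, Im c3. -/

import Mathlib

open Set Complex

/-- If ψ = (c1, c2, c3) solves the Schrödinger equation i dψ/dt = H(t) ψ with
H12 = H21 = Δ, H23 = H32 = u(t) and zero elsewhere, then the real variables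
x1 = Re c1, x2 = −Im c2, x3 = −Re c3 satisfy the closed real system
ẋ1 = −Δ x2, ẋ2 = Δ x1 − u x3, ẋ3 = u x2. -/
theorem real_dynamics_decouple
    (Δ : ℝ) (u : ℝ → ℝ) (hu : Continuous u)
    (c1 c2 c3 : ℝ → ℂ)
    (hc1 : ∀ t, HasDerivAt c1 (-Complex.I * ((Δ : ℂ) * c2 t)) t)
    (hc2 : ∀ t, HasDerivAt c2 (-Complex.I * ((Δ : ℂ) * c1 t + (u t : ℂ) * c3 t)) t)
    (hc3 : ∀ t, HasDerivAt c3 (-Complex.I * ((u t : ℂ) * c2 t)) t) :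
    (∀ t, HasDerivAt (fun s => (c1 s).re) (-Δ * (-(c2 t).im)) t) ∧
    (∀ t, HasDerivAt (fun s => -(c2 s).im) (Δ * (c1 t).re - u t * (-(c3 t).re)) t) ∧
    (∀ t, HasDerivAt (fun s => -(c3 s).re) (u t * (-(c2 t).im)) t) := by
  have re_deriv {c : ℝ → ℂ} {c' : ℂ} {t : ℝ} (h : HasDerivAt c c' t) :
      HasDerivAt (fun s => (c s).re) c'.re t :=
    Complex.reCLM.hasFDerivAt.comp_hasDerivAt t h
  have im_deriv {c : ℝ → ℂ} {c' : ℂ} {t : ℝ} (h : HasDerivAt c c' t) :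
      HasDerivAt (fun s => (c s).im) c'.im t :=
    Complex.imCLM.hasFDerivAt.comp_hasDerivAt t h
  refine ⟨fun t => ?_, fun t => ?_, fun t => ?_⟩
  · exact (re_deriv (hc1 t)).congr_deriv (by simp)
  · exact (im_deriv (hc2 t)).fun_neg.congr_deriv (by simp)
  · exact (re_deriv (hc3 t)).fun_neg.congr_deriv (by simp)
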